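/- The limiting measures satisfy the modified Cauchy–Riemann relations in the sense of distributions: for every φ ∈ C_c^∞(Ω,ℝ), ∫_Ω (∂φ/∂x₂) d(2μ_{⋆,1,2}) = ∫_Ω (∂φ/∂x₁) d(2ζ_⋆ − μ_{⋆,1,1} + μ_{⋆,2,2}) and ∫_Ω (∂φ/∂x₁) d(2μ_{⋆,1,2}) = ∫_Ω (∂φ/∂x₂) d(2ζ_⋆ + μ_{⋆,1,1} − μ_{⋆,2,2}). -/

import Mathlib

open MeasureTheory Metric Filter Topology Bornology
open scoped RealInnerProductSpace ENNReal Topology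

noncomputable section

/-- The euclidean plane. -/
abbrev E2 : Type := EuclideanSpace ℝ (Fin 2)

/-- The euclidean space `ℝ^k`. -/
abbrev Evec (k : ℕ) : Type := EuclideanSpace ℝ (Fin k)

/-- The `i`-th standard basis vector of the plane. -/
def b2 (i : Fin 2) : E2 := EuclideanSpace.single i (1 : ℝ)

/-- The partial derivative of `u` in the `i`-th coordinate direction. -/
def pder {k : ℕ} (u : E2 → Evec k) (i : Fin 2) (x : E2) : Evec k :=
  fderiv ℝ u x (b2 i)

/-- The Laplacian of a map defined on the plane. -/
def lap {k : ℕ} (u : E2 → Evec k) (x : E2) : Evec k :=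
  ∑ i : Fin 2, fderiv ℝ (pder u i) x (b2 i)

/-- `u` is a smooth solution of the vectorial Allen-Cahn system
`Δu = ε⁻² ∇V(u)` on the open set `U`. -/
def IsSolution {k : ℕ} (V : Evec k → ℝ) (ε : ℝ) (U : Set E2) (u : E2 → Evec k) : Prop :=
  ContDiffOn ℝ (⊤ : ℕ∞) u U ∧ ∀ x ∈ U, lap u x = (ε ^ 2)⁻¹ • gradient V (u x)

/-- The squared modulus `|∇u|²` of the full gradient. -/
def gradSq {k : ℕ} (u : E2 → Evec k) (x : E2) : ℝ :=
  ∑ i : Fin 2, ‖pder u i x‖ ^ 2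

/-- The energy density `e_ε(u) = (ε/2)|∇u|² + ε⁻¹ V(u)`. -/
def eDens {k : ℕ} (V : Evec k → ℝ) (ε : ℝ) (u : E2 → Evec k) (x : E2) : ℝ :=
  ε / 2 * gradSq u x + ε⁻¹ * V (u x)

/-- The energy `E_ε(u, G)`. -/
def energy {k : ℕ} (V : Evec k → ℝ) (ε : ℝ) (u : E2 → Evec k) (G : Set E2) : ℝ :=
  ∫ x in G, eDens V ε u x

/-- The hypotheses (H₁), (H₂), (H₃) on the multi-well potential `V`:
smooth, nonnegative with `inf V = 0`, finitely many zeros (at least two),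
positive definite Hessian at each zero, quadratic growth of `y·∇V(y)` at
infinity and coercivity. -/
structure IsMultiWell {k : ℕ} (V : Evec k → ℝ) : Prop where
  smooth : ContDiff ℝ (⊤ : ℕ∞) V
  nonneg : ∀ y, 0 ≤ V y
  finite_zeros : {y : Evec k | V y = 0}.Finite
  two_le_card : 2 ≤ {y : Evec k | V y = 0}.ncard
  hess_posdef : ∀ σ : Evec k, V σ = 0 → ∀ w : Evec k, w ≠ 0 →
    0 < iteratedFDeriv ℝ 2 V σ ![w, w]
  growth : ∃ α > (0 : ℝ), ∃ R > (0 : ℝ), ∀ y : Evec k, R < ‖y‖ →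
    α * ‖y‖ ^ 2 ≤ ⟪y, gradient V y⟫
  coercive : ∀ C : ℝ, ∃ R : ℝ, ∀ y : Evec k, R ≤ ‖y‖ → C ≤ V y

/-- A continuous test function compactly supported in `Ω`. -/
def TestFun (Ω : Set E2) (f : E2 → ℝ) : Prop :=
  Continuous f ∧ HasCompactSupport f ∧ tsupport f ⊆ Ω

/-- The lower one-dimensional density of the measure `ν` at `x`. -/
def densLow (ν : Measure E2) (x : E2) : ℝ :=
  Filter.liminf (fun r : ℝ => (ν (closedBall x r)).toReal / r) (𝓝[>] 0)

/-- The concentration set `𝔖⋆ = {x ∈ Ω | liminf_{r→0} ν(D̄(x,r))/r ≥ η}`. -/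
def concSet (ν : Measure E2) (Ω : Set E2) (η : ℝ) : Set E2 :=
  {x ∈ Ω | η ≤ densLow ν x}

/-- The product of a compactly supported continuous function and a function continuous on a
neighbourhood of its support is integrable. -/
theorem integrable_mul_of_continuousOn {Ω : Set E2} (hΩ : IsOpen Ω) {h F : E2 → ℝ}
    (hh : TestFun Ω h) (hF : ContinuousOn F Ω) : Integrable (fun x => h x * F x) := by
  obtain ⟨hc, hcs, hsub⟩ := hh
  have hcont : Continuous (fun x => h x * F x) :=
    (hc.continuousOn.mul hF).continuous_of_tsupport_subset hΩ
      (tsupport_mul_subset_left.trans hsub)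
  exact hcont.integrable_of_hasCompactSupport hcs.mul_right

/-- A directional derivative of a smooth function compactly supported in `Ω` is a test function. -/
theorem testFun_fderiv_apply {Ω : Set E2} {φ : E2 → ℝ} (hφ : ContDiff ℝ (⊤ : ℕ∞) φ)
    (hφc : HasCompactSupport φ) (hφΩ : tsupport φ ⊆ Ω) (v : E2) :
    TestFun Ω (fun x => fderiv ℝ φ x v) :=
  ⟨(hφ.continuous_fderiv (by simp)).clm_apply continuous_const, hφc.fderiv_apply ℝ v,
    (tsupport_fderiv_apply_subset ℝ v).trans hφΩ⟩

/-- Integration by parts on an open set against a compactly supported function. -/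
theorem integral_fderiv_mul_eq_neg {Ω : Set E2} (hΩ : IsOpen Ω) {φ F : E2 → ℝ}
    (hφ : ContDiff ℝ (⊤ : ℕ∞) φ) (hφc : HasCompactSupport φ) (hφΩ : tsupport φ ⊆ Ω)
    (hF : ContDiffOn ℝ 1 F Ω) (v : E2) :
    ∫ x, fderiv ℝ φ x v * F x = -∫ x, φ x * fderiv ℝ F x v := by
  have hφt : TestFun Ω φ := ⟨hφ.continuous, hφc, hφΩ⟩
  rw [integral_mul_fderiv_eq_neg_fderiv_mul_of_integrable, neg_neg]
  · exact integrable_mul_of_continuousOn hΩ (testFun_fderiv_apply hφ hφc hφΩ v) hF.continuousOn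
  · exact integrable_mul_of_continuousOn hΩ hφt
      ((hF.continuousOn_fderiv_of_isOpen hΩ le_rfl).clm_apply continuousOn_const)
  · exact integrable_mul_of_continuousOn hΩ hφt hF.continuousOn
  · exact fun x _ => (hφ.differentiable (by simp)) x
  · exact fun x hx => (hF.differentiableOn (by simp)).differentiableAt (hΩ.mem_nhds (hφΩ hx))

/-- The partial derivatives of a smooth map are smooth. -/
theorem contDiffOn_pder {k : ℕ} {Ω : Set E2} (hΩ : IsOpen Ω) {u : E2 → Evec k}
    (hu : ContDiffOn ℝ (⊤ : ℕ∞) u Ω) (i : Fin 2) : ContDiffOn ℝ 1 (pder u i) Ω :=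
  (hu.fderiv_of_isOpen (m := 1) hΩ (by norm_num; exact ENat.LEInfty.out)).clm_apply contDiffOn_const

/-- Mixed second partial derivatives of a smooth map commute. -/
theorem fderiv_pder_comm {k : ℕ} {Ω : Set E2} (hΩ : IsOpen Ω) {u : E2 → Evec k}
    (hu : ContDiffOn ℝ (⊤ : ℕ∞) u Ω) {x : E2} (hx : x ∈ Ω) (i j : Fin 2) :
    fderiv ℝ (pder u i) x (b2 j) = fderiv ℝ (pder u j) x (b2 i) := by
  have hux : ContDiffAt ℝ (⊤ : ℕ∞) u x := hu.contDiffAt (hΩ.mem_nhds hx)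
  have hd : DifferentiableAt ℝ (fderiv ℝ u) x :=
    (hux.fderiv_right (m := 1) (by norm_num; exact ENat.LEInfty.out)).differentiableAt (by simp)
  have hp : ∀ l w, fderiv ℝ (pder u l) x w = fderiv ℝ (fderiv ℝ u) x w (b2 l) := by
    intro l w
    unfold pder
    rw [fderiv_clm_apply hd (differentiableAt_const _)]
    simp
  rw [hp, hp]
  exact (hux.isSymmSndFDerivAt (by
    rw [minSmoothness_of_isRCLikeNormedField]
    exact ENat.LEInfty.out)) _ _

/-- The stress-energy tensor of a solution is divergence free, pointwise. -/
theorem divergence_stress_eq_zero {k : ℕ} {V : Evec k → ℝ} (hV : ContDiff ℝ (⊤ : ℕ∞) V)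
    {Ω : Set E2} (hΩ : IsOpen Ω) {ε : ℝ} (hε : 0 < ε) {u : E2 → Evec k}
    (hu : IsSolution V ε Ω u) {i j : Fin 2} (hij : i ≠ j) {x : E2} (hx : x ∈ Ω) :
    fderiv ℝ (fun x => 2 * (ε * ⟪pder u i x, pder u j x⟫)) x (b2 j) +
      fderiv ℝ (fun x => ε * ⟪pder u i x, pder u i x⟫ - ε * ⟪pder u j x, pder u j x⟫
        - 2 * (ε⁻¹ * V (u x))) x (b2 i) = 0 := by
  have hdp : ∀ l, DifferentiableAt ℝ (pder u l) x := fun l =>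
    ((contDiffOn_pder hΩ hu.1 l).differentiableOn (by simp)).differentiableAt (hΩ.mem_nhds hx)
  have hdu : DifferentiableAt ℝ u x :=
    (hu.1.differentiableOn (by simp)).differentiableAt (hΩ.mem_nhds hx)
  have hdV : DifferentiableAt ℝ V (u x) := hV.differentiable (by simp) _
  have hin : ∀ l m, HasFDerivAt (fun x => ⟪pder u l x, pder u m x⟫) _ x := fun l m =>
    (hdp l).hasFDerivAt.inner ℝ (hdp m).hasFDerivAt
  have hVu : HasFDerivAt (fun x => V (u x)) _ x := hdV.hasFDerivAt.comp x hdu.hasFDerivAt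
  rw [(((hin i j).const_mul ε).const_mul 2).fderiv,
    ((((hin i i).const_mul ε).fun_sub ((hin j j).const_mul ε)).fun_sub
      ((hVu.const_mul ε⁻¹).const_mul 2)).fderiv]
  have hlap : fderiv ℝ (pder u i) x (b2 i) + fderiv ℝ (pder u j) x (b2 j) =
      (ε ^ 2)⁻¹ • gradient V (u x) := by
    rw [← hu.2 x hx, lap, Fin.sum_univ_two]
    fin_cases i <;> fin_cases j <;> simp_all [add_comm]
  have hgrad : fderiv ℝ V (u x) (fderiv ℝ u x (b2 i)) =
      ε ^ 2 * (⟪fderiv ℝ (pder u i) x (b2 i), pder u i x⟫ +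
        ⟪fderiv ℝ (pder u j) x (b2 j), pder u i x⟫) := by
    rw [← inner_add_left, hlap, ← toDual_gradient, InnerProductSpace.toDual_apply_apply,
      real_inner_smul_left, mul_inv_cancel_left₀ (by positivity)]
    rfl
  have hcomm := fderiv_pder_comm hΩ hu.1 hx i j
  simp [hgrad, hcomm, real_inner_comm]
  field_simp
  ring

/-- The weak form of the vanishing of the divergence of the stress-energy tensor. -/
theorem integral_stress_identity {k : ℕ} {V : Evec k → ℝ} (hV : ContDiff ℝ (⊤ : ℕ∞) V)
    {Ω : Set E2} (hΩ : IsOpen Ω) {ε : ℝ} (hε : 0 < ε) {u : E2 → Evec k}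
    (hu : IsSolution V ε Ω u) {i j : Fin 2} (hij : i ≠ j) {φ : E2 → ℝ}
    (hφ : ContDiff ℝ (⊤ : ℕ∞) φ) (hφc : HasCompactSupport φ) (hφΩ : tsupport φ ⊆ Ω) :
    2 * (∫ x in Ω, fderiv ℝ φ x (b2 j) * (ε * ⟪pder u i x, pder u j x⟫)) =
      2 * (∫ x in Ω, fderiv ℝ φ x (b2 i) * (ε⁻¹ * V (u x)))
        - (∫ x in Ω, fderiv ℝ φ x (b2 i) * (ε * ⟪pder u i x, pder u i x⟫))
        + ∫ x in Ω, fderiv ℝ φ x (b2 i) * (ε * ⟪pder u j x, pder u j x⟫) := by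
  have htest := testFun_fderiv_apply hφ hφc hφΩ
  have hset : ∀ (v : E2) (F : E2 → ℝ),
      ∫ x in Ω, fderiv ℝ φ x v * F x = ∫ x, fderiv ℝ φ x v * F x := fun v F =>
    setIntegral_eq_integral_of_forall_compl_eq_zero fun x hx => by
      rw [image_eq_zero_of_notMem_tsupport (f := fun x => fderiv ℝ φ x v)
        (fun h => hx ((htest v).2.2 h)), zero_mul]
  have hP : ∀ l m, ContDiffOn ℝ 1 (fun x => ε * ⟪pder u l x, pder u m x⟫) Ω := fun l m =>
    contDiffOn_const.mul ((contDiffOn_pder hΩ hu.1 l).inner ℝ (contDiffOn_pder hΩ hu.1 m))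
  have hW : ContDiffOn ℝ 1 (fun x => ε⁻¹ * V (u x)) Ω :=
    contDiffOn_const.mul ((hV.of_le (mod_cast le_top)).comp_contDiffOn
      (hu.1.of_le (mod_cast le_top)))
  have hA : ContDiffOn ℝ 1 (fun x => 2 * (ε * ⟪pder u i x, pder u j x⟫)) Ω :=
    contDiffOn_const.mul (hP i j)
  have hB : ContDiffOn ℝ 1 (fun x => ε * ⟪pder u i x, pder u i x⟫
      - ε * ⟪pder u j x, pder u j x⟫ - 2 * (ε⁻¹ * V (u x))) Ω :=
    ((hP i i).sub (hP j j)).sub (contDiffOn_const.mul hW)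
  have hIA := integral_fderiv_mul_eq_neg hΩ hφ hφc hφΩ hA (b2 j)
  have hIB := integral_fderiv_mul_eq_neg hΩ hφ hφc hφΩ hB (b2 i)
  have hdiv : ∫ x, φ x * fderiv ℝ (fun x => 2 * (ε * ⟪pder u i x, pder u j x⟫)) x (b2 j) =
      -∫ x, φ x * fderiv ℝ (fun x => ε * ⟪pder u i x, pder u i x⟫
        - ε * ⟪pder u j x, pder u j x⟫ - 2 * (ε⁻¹ * V (u x))) x (b2 i) := by
    rw [← integral_neg]
    refine integral_congr_ae (Eventually.of_forall fun x => ?_)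
    by_cases hx : x ∈ Ω
    · have h := divergence_stress_eq_zero hV hΩ hε hu hij hx
      simp only [eq_neg_of_add_eq_zero_left h, mul_neg]
    · simp [image_eq_zero_of_notMem_tsupport fun h => hx (hφΩ h)]
  have hint : ∀ (v : E2) {F : E2 → ℝ}, ContDiffOn ℝ 1 F Ω →
      Integrable (fun x => fderiv ℝ φ x v * F x) := fun v F hF =>
    integrable_mul_of_continuousOn hΩ (htest v) hF.continuousOn
  have hsplitA : ∫ x, fderiv ℝ φ x (b2 j) * (2 * (ε * ⟪pder u i x, pder u j x⟫)) =
      2 * ∫ x, fderiv ℝ φ x (b2 j) * (ε * ⟪pder u i x, pder u j x⟫) := by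
    rw [← integral_const_mul]
    exact integral_congr_ae (Eventually.of_forall fun x => by ring)
  have hsplitB : ∫ x, fderiv ℝ φ x (b2 i) * (ε * ⟪pder u i x, pder u i x⟫
        - ε * ⟪pder u j x, pder u j x⟫ - 2 * (ε⁻¹ * V (u x))) =
      (∫ x, fderiv ℝ φ x (b2 i) * (ε * ⟪pder u i x, pder u i x⟫))
        - (∫ x, fderiv ℝ φ x (b2 i) * (ε * ⟪pder u j x, pder u j x⟫))
        - 2 * ∫ x, fderiv ℝ φ x (b2 i) * (ε⁻¹ * V (u x)) := by
    have hsub : Integrable (fun x => fderiv ℝ φ x (b2 i) * (ε * ⟪pder u i x, pder u i x⟫)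
        - fderiv ℝ φ x (b2 i) * (ε * ⟪pder u j x, pder u j x⟫)) :=
      (hint _ (hP i i)).sub (hint _ (hP j j))
    rw [← integral_const_mul, ← integral_sub (hint _ (hP i i)) (hint _ (hP j j)),
      ← integral_sub hsub ((hint _ hW).const_mul 2)]
    exact integral_congr_ae (Eventually.of_forall fun x => by ring)
  simp only [hset]
  linarith

/-- modified Cauchy–Riemann relations for the limiting
measures. For every test function `φ` compactly supported in `Ω`:
`∫ ∂₂φ d(2μ_{⋆,1,2}) = ∫ ∂₁φ d(2ζ − μ_{⋆,1,1} + μ_{⋆,2,2})` and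
`∫ ∂₁φ d(2μ_{⋆,1,2}) = ∫ ∂₂φ d(2ζ + μ_{⋆,1,1} − μ_{⋆,2,2})`, where the signed
measures `μ_{⋆,i,j}` are encoded by their Jordan decompositions `μp i j − μm i j`. -/
theorem statement_9 (k : ℕ) (hk : 1 ≤ k) (V : Evec k → ℝ) (hV : IsMultiWell V)
    (Ω : Set E2) (hΩo : IsOpen Ω) (hΩb : IsBounded Ω)
    (M₀ : ℝ) (hM₀ : 0 < M₀)
    (ε : ℕ → ℝ) (u : ℕ → E2 → Evec k)
    (hε : ∀ n, 0 < ε n) (hε0 : Tendsto ε atTop (𝓝 0))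
    (hsol : ∀ n, IsSolution V (ε n) Ω (u n))
    (hint : ∀ n, IntegrableOn (eDens V (ε n) (u n)) Ω)
    (hbd : ∀ n, energy V (ε n) (u n) Ω ≤ M₀)
    (ζ : Measure E2) (hζfin : IsFiniteMeasure ζ) (hζsupp : ζ Ωᶜ = 0)
    (μp μm : Fin 2 → Fin 2 → Measure E2)
    (hμpfin : ∀ i j, IsFiniteMeasure (μp i j)) (hμmfin : ∀ i j, IsFiniteMeasure (μm i j))
    (hμpsupp : ∀ i j, μp i j Ωᶜ = 0) (hμmsupp : ∀ i j, μm i j Ωᶜ = 0)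
    (hζconv : ∀ f : E2 → ℝ, TestFun Ω f →
      Tendsto (fun n => ∫ x in Ω, f x * ((ε n)⁻¹ * V (u n x))) atTop
        (𝓝 (∫ x, f x ∂ζ)))
    (hμconv : ∀ i j, ∀ f : E2 → ℝ, TestFun Ω f →
      Tendsto (fun n => ∫ x in Ω, f x * (ε n * ⟪pder (u n) i x, pder (u n) j x⟫))
        atTop (𝓝 ((∫ x, f x ∂μp i j) - ∫ x, f x ∂μm i j)))
    (φ : E2 → ℝ) (hφ : ContDiff ℝ (⊤ : ℕ∞) φ) (hφc : HasCompactSupport φ)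
    (hφΩ : tsupport φ ⊆ Ω) :
    2 * ((∫ x, fderiv ℝ φ x (b2 1) ∂μp 0 1) - ∫ x, fderiv ℝ φ x (b2 1) ∂μm 0 1) =
      2 * (∫ x, fderiv ℝ φ x (b2 0) ∂ζ)
        - ((∫ x, fderiv ℝ φ x (b2 0) ∂μp 0 0) - ∫ x, fderiv ℝ φ x (b2 0) ∂μm 0 0)
        + ((∫ x, fderiv ℝ φ x (b2 0) ∂μp 1 1) - ∫ x, fderiv ℝ φ x (b2 0) ∂μm 1 1) ∧
    2 * ((∫ x, fderiv ℝ φ x (b2 0) ∂μp 0 1) - ∫ x, fderiv ℝ φ x (b2 0) ∂μm 0 1) =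
      2 * (∫ x, fderiv ℝ φ x (b2 1) ∂ζ)
        + ((∫ x, fderiv ℝ φ x (b2 1) ∂μp 0 0) - ∫ x, fderiv ℝ φ x (b2 1) ∂μm 0 0)
        - ((∫ x, fderiv ℝ φ x (b2 1) ∂μp 1 1) - ∫ x, fderiv ℝ φ x (b2 1) ∂μm 1 1) := by
  have htest := testFun_fderiv_apply hφ hφc hφΩ
  have key : ∀ i j : Fin 2, i ≠ j →
      2 * ((∫ x, fderiv ℝ φ x (b2 j) ∂μp i j) - ∫ x, fderiv ℝ φ x (b2 j) ∂μm i j) =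
        2 * (∫ x, fderiv ℝ φ x (b2 i) ∂ζ)
          - ((∫ x, fderiv ℝ φ x (b2 i) ∂μp i i) - ∫ x, fderiv ℝ φ x (b2 i) ∂μm i i)
          + ((∫ x, fderiv ℝ φ x (b2 i) ∂μp j j) - ∫ x, fderiv ℝ φ x (b2 i) ∂μm j j) := by
    intro i j hij
    refine tendsto_nhds_unique ((hμconv i j _ (htest (b2 j))).const_mul 2) ?_
    simp only [integral_stress_identity hV.smooth hΩo (hε _) (hsol _) hij hφ hφc hφΩ]
    exact (((hζconv _ (htest (b2 i))).const_mul 2).sub (hμconv i i _ (htest (b2 i)))).add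
      (hμconv j j _ (htest (b2 i)))
  have hsymm : (∫ x, fderiv ℝ φ x (b2 0) ∂μp 0 1) - ∫ x, fderiv ℝ φ x (b2 0) ∂μm 0 1 =
      (∫ x, fderiv ℝ φ x (b2 0) ∂μp 1 0) - ∫ x, fderiv ℝ φ x (b2 0) ∂μm 1 0 := by
    refine tendsto_nhds_unique (hμconv 0 1 _ (htest (b2 0))) ?_
    simpa only [real_inner_comm] using hμconv 1 0 _ (htest (b2 0))
  refine ⟨key 0 1 (by simp), ?_⟩
  rw [hsymm, key 1 0 (by simp)]
  ring
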